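/- Let S be a semigroup, ω a congruence on S, and f₁, f₂ : S → [0,1]. Writing f̄ᵢ(z) = ⨆_{z' ∈ [z]ω} fᵢ(z') for the upper approximations, for every z ∈ S one has (f̄₁ ∘ f̄₂)(z) ≤ ⨆_{λ ∈ [z]ω} (f₁ ∘ f₂)(λ); that is, the sup-min composition of the upper approximations is pointwise below the upper approximation of the sup-min composition. (Theorem 3.2, membership component.) -/

import Mathlib

open unitInterval

instance : Fact ((0:ℝ) ≤ 1) := ⟨zero_le_one⟩

/-- Lower rough approximation: infimum of `f` over the ω-class of `z`. -/
noncomputable def lowerApp {S : Type*} (ω : S → S → Prop) (f : S → unitInterval) (z : S) :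
    unitInterval :=
  ⨅ z' : {z' : S // ω z z'}, f z'.1

/-- Upper rough approximation: supremum of `f` over the ω-class of `z`. -/
noncomputable def upperApp {S : Type*} (ω : S → S → Prop) (f : S → unitInterval) (z : S) :
    unitInterval :=
  ⨆ z' : {z' : S // ω z z'}, f z'.1

/-- Sup-min composition of two fuzzy sets on a semigroup. -/
noncomputable def supMinComp {S : Type*} [Semigroup S] (f g : S → unitInterval) (z : S) :
    unitInterval :=
  ⨆ p : {p : S × S // p.1 * p.2 = z}, min (f p.1.1) (g p.1.2)

/-- Inf-max composition of two fuzzy sets on a semigroup. -/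
noncomputable def infMaxComp {S : Type*} [Semigroup S] (f g : S → unitInterval) (z : S) :
    unitInterval :=
  ⨅ p : {p : S × S // p.1 * p.2 = z}, max (f p.1.1) (g p.1.2)

theorem supMinComp_upperApp_le {S : Type*} [Semigroup S]
    (ω : S → S → Prop) (hEquiv : Equivalence ω)
    (hCong : ∀ x x' y y', ω x x' → ω y y' → ω (x * y) (x' * y'))
    (f₁ f₂ : S → unitInterval) :
    ∀ z : S, supMinComp (upperApp ω f₁) (upperApp ω f₂) z ≤ upperApp ω (supMinComp f₁ f₂) z := by
  intro z
  refine iSup_le fun ⟨⟨a, b⟩, hab⟩ => ?_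
  subst hab
  change (⨆ a' : {a' : S // ω a a'}, f₁ a'.1) ⊓ (⨆ b' : {b' : S // ω b b'}, f₂ b'.1) ≤ _
  rw [iSup_inf_iSup]
  refine iSup_le fun ⟨⟨a', ha⟩, ⟨b', hb⟩⟩ => ?_
  calc f₁ a' ⊓ f₂ b' ≤ supMinComp f₁ f₂ (a' * b') :=
        le_iSup (fun p : {p : S × S // p.1 * p.2 = a' * b'} => min (f₁ p.1.1) (f₂ p.1.2))
          ⟨(a', b'), rfl⟩
    _ ≤ upperApp ω (supMinComp f₁ f₂) (a * b) :=
        le_iSup (fun z' : {z' : S // ω (a * b) z'} => supMinComp f₁ f₂ z'.1)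
          ⟨a' * b', hCong a a' b b' ha hb⟩
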